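/- arXiv:2406.18798 — 4 statements merged into one kernel-verified Lean document; each statement's English description precedes it below -/
import Mathlib

section
/- Let A and B be finite nonempty subsets of an abelian group, and let U_A and U_B be independent random variables, uniformly distributed on A and on B respectively. Then log(|A|²·|B|²/|A+B|) ≤ A{U_A, U_B} ≤ log E(A,B), where A+B is the sumset {a+b : a ∈ A, b ∈ B}. -/
open MeasureTheory ProbabilityTheory Real Pointwise

/-- Shannon entropy (base 2) of a discrete random variable `X : Ω → S`
under the measure `μ`. -/
noncomputable def entH {Ω S : Type*} [MeasurableSpace Ω] (μ : Measure Ω) (X : Ω → S) : ℝ :=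
  ∑' s : S, -((μ (X ⁻¹' {s})).toReal * Real.logb 2 (μ (X ⁻¹' {s})).toReal)

/-- The random variable `X` has finite (Shannon) entropy. -/
def FinEnt {Ω S : Type*} [MeasurableSpace Ω] (μ : Measure Ω) (X : Ω → S) : Prop :=
  Summable fun s : S => -((μ (X ⁻¹' {s})).toReal * Real.logb 2 (μ (X ⁻¹' {s})).toReal)

/-- Conditional Shannon entropy (base 2) `H{X | Z} = ∑ₜ P(Z = t) · H{X | Z = t}`. -/
noncomputable def condEntH {Ω S T : Type*} [MeasurableSpace Ω] (μ : Measure Ω)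
    (X : Ω → S) (Z : Ω → T) : ℝ :=
  ∑' t : T, (μ (Z ⁻¹' {t})).toReal * entH (μ[|Z ⁻¹' {t}]) X

/-- The additive energy `E(A,B)`: the number of quadruples `(a, a', b, b')` in
`A × A × B × B` with `a + b = a' + b'`. -/
def addEnergy {G : Type*} [AddCommGroup G] [DecidableEq G] (A B : Finset G) : ℕ :=
  (((A ×ˢ A) ×ˢ B ×ˢ B).filter fun x => x.1.1 + x.2.1 = x.1.2 + x.2.2).card

lemma aux_jensen {S : Type*} (T : Finset S) (w x : S → ℝ) (hw : ∀ i ∈ T, 0 < w i)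
    (h1 : ∑ i ∈ T, w i = 1) (hx : ∀ i ∈ T, 0 < x i) :
    ∑ i ∈ T, w i * Real.logb 2 (x i) ≤ Real.logb 2 (∑ i ∈ T, w i * x i) := by
  have h := strictConcaveOn_log_Ioi.concaveOn.le_map_sum (t := T) (w := w) (p := x)
    (fun i hi => (hw i hi).le) h1 (fun i hi => hx i hi)
  simp only [smul_eq_mul] at h
  have h2 : (0:ℝ) < Real.log 2 := Real.log_pos (by norm_num)
  simp only [Real.logb, ← mul_div_assoc, ← Finset.sum_div]
  gcongr

lemma aux_joint {Ω G : Type*} [MeasurableSpace Ω] [AddCommGroup G] [DecidableEq G]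
    [MeasurableSpace G] [MeasurableSingletonClass G]
    (μ : Measure Ω) [IsProbabilityMeasure μ]
    (A B : Finset G) 
    (U_A U_B : Ω → G) 
    (hunifA : ∀ g : G, μ (U_A ⁻¹' {g}) = if g ∈ A then (A.card : ENNReal)⁻¹ else 0)
    (hunifB : ∀ g : G, μ (U_B ⁻¹' {g}) = if g ∈ B then (B.card : ENNReal)⁻¹ else 0)
    (hindep : IndepFun U_A U_B μ) (x : G × G) :
    (μ ((fun ω => (U_A ω, U_B ω)) ⁻¹' {x})).toReal =
      if x ∈ A ×ˢ B then ((A.card : ℝ) * B.card)⁻¹ else 0 := by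
  have h := hindep.measure_inter_preimage_eq_mul {x.1} {x.2}
    (measurableSet_singleton _) (measurableSet_singleton _)
  have e : (fun ω => (U_A ω, U_B ω)) ⁻¹' {x} = U_A ⁻¹' {x.1} ∩ U_B ⁻¹' {x.2} := by
    ext ω; simp [Prod.ext_iff]
  rw [e, h, hunifA, hunifB]
  by_cases h1 : x.1 ∈ A <;> by_cases h2 : x.2 ∈ B <;> simp [h1, h2, mul_comm]

lemma aux_supp {Ω G : Type*} [MeasurableSpace Ω] [DecidableEq G]
    [MeasurableSpace G] [MeasurableSingletonClass G]
    (μ : Measure Ω) [IsProbabilityMeasure μ]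
    (A : Finset G) (hA : A.Nonempty)
    (U : Ω → G) (hm : Measurable U)
    (hunif : ∀ g : G, μ (U ⁻¹' {g}) = if g ∈ A then (A.card : ENNReal)⁻¹ else 0) :
    ∀ᵐ ω ∂μ, U ω ∈ A := by
  have hms : MeasurableSet (U ⁻¹' (A : Set G)) := hm A.measurableSet
  have h : μ (U ⁻¹' (A : Set G)) = 1 := by
    rw [← sum_measure_preimage_singleton A (fun y _ => hm (measurableSet_singleton y)),
      Finset.sum_congr rfl (fun g hg => by rw [hunif g, if_pos hg])]
    rw [Finset.sum_const, nsmul_eq_mul]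
    exact ENNReal.mul_inv_cancel (by simpa using hA.ne_empty) (by simp)
  exact (prob_compl_eq_zero_iff hms).2 h

lemma aux_sum {Ω G : Type*} [MeasurableSpace Ω] [AddCommGroup G] [DecidableEq G]
    [MeasurableSpace G] [MeasurableSingletonClass G]
    (μ : Measure Ω) [IsProbabilityMeasure μ]
    (A B : Finset G) (hA : A.Nonempty) (hB : B.Nonempty)
    (U_A U_B : Ω → G) (hmA : Measurable U_A) (hmB : Measurable U_B)
    (hunifA : ∀ g : G, μ (U_A ⁻¹' {g}) = if g ∈ A then (A.card : ENNReal)⁻¹ else 0)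
    (hunifB : ∀ g : G, μ (U_B ⁻¹' {g}) = if g ∈ B then (B.card : ENNReal)⁻¹ else 0)
    (hindep : IndepFun U_A U_B μ) (s : G) :
    (μ ((fun ω => U_A ω + U_B ω) ⁻¹' {s})).toReal =
      ((A ×ˢ B).filter fun x => x.1 + x.2 = s).card / ((A.card : ℝ) * B.card) := by
  have hms : ∀ y : G × G, MeasurableSet ((fun ω => (U_A ω, U_B ω)) ⁻¹' {y}) := fun y => by
    have e : (fun ω => (U_A ω, U_B ω)) ⁻¹' {y} = U_A ⁻¹' {y.1} ∩ U_B ⁻¹' {y.2} := by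
      ext ω; simp [Prod.ext_iff]
    rw [e]
    exact (hmA (measurableSet_singleton _)).inter (hmB (measurableSet_singleton _))
  have e : μ ((fun ω => U_A ω + U_B ω) ⁻¹' {s}) =
      μ ((fun ω => (U_A ω, U_B ω)) ⁻¹'
        (((A ×ˢ B).filter fun x => x.1 + x.2 = s : Finset (G × G)) : Set (G × G))) := by
    apply measure_congr
    filter_upwards [aux_supp μ A hA U_A hmA hunifA, aux_supp μ B hB U_B hmB hunifB] with ω h1 h2
    apply propext
    change U_A ω + U_B ω = s ↔ (U_A ω, U_B ω) ∈ (((A ×ˢ B).filter fun x => x.1 + x.2 = s : Finset (G × G)) : Set (G × G))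
    simp [h1, h2]
  rw [e, ← sum_measure_preimage_singleton _ (fun y _ => hms y),
    ENNReal.toReal_sum (fun _ _ => measure_ne_top _ _)]
  rw [Finset.sum_congr rfl (fun x hx => by
    rw [aux_joint μ A B U_A U_B hunifA hunifB hindep x, if_pos (Finset.mem_filter.1 hx).1])]
  rw [Finset.sum_const, nsmul_eq_mul, div_eq_mul_inv]

/-- If `U_A` and `U_B` are independent random variables uniformly distributed on the
finite nonempty sets `A` and `B` respectively, then
`log(|A|²|B|²/|A+B|) ≤ 𝐀{U_A, U_B} ≤ log E(A,B)`, where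
`𝐀{X,Y} = 2·H{X,Y} − H{X+Y}` is the entropic additive energy. -/
theorem stmt0 {Ω G : Type*} [MeasurableSpace Ω] [AddCommGroup G] [DecidableEq G]
    [MeasurableSpace G] [MeasurableSingletonClass G]
    (μ : Measure Ω) [IsProbabilityMeasure μ]
    (A B : Finset G) (hA : A.Nonempty) (hB : B.Nonempty)
    (U_A U_B : Ω → G) (hmA : Measurable U_A) (hmB : Measurable U_B)
    (hunifA : ∀ g : G, μ (U_A ⁻¹' {g}) = if g ∈ A then (A.card : ENNReal)⁻¹ else 0)
    (hunifB : ∀ g : G, μ (U_B ⁻¹' {g}) = if g ∈ B then (B.card : ENNReal)⁻¹ else 0)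
    (hindep : IndepFun U_A U_B μ) :
    Real.logb 2 (((A.card : ℝ) ^ 2 * (B.card : ℝ) ^ 2) / ((A + B).card : ℝ))
        ≤ 2 * entH μ (fun ω => (U_A ω, U_B ω)) - entH μ (fun ω => U_A ω + U_B ω) ∧
      2 * entH μ (fun ω => (U_A ω, U_B ω)) - entH μ (fun ω => U_A ω + U_B ω)
        ≤ Real.logb 2 (addEnergy A B) := by
  have ha : (0:ℝ) < A.card := by exact_mod_cast hA.card_pos
  have hb : (0:ℝ) < B.card := by exact_mod_cast hB.card_pos
  set N : ℝ := (A.card : ℝ) * B.card with hN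
  have hN0 : 0 < N := mul_pos ha hb
  set r : G → ℕ := fun s => ((A ×ˢ B).filter fun x => x.1 + x.2 = s).card with hr
  have hj : entH μ (fun ω => (U_A ω, U_B ω)) = Real.logb 2 N := by
    unfold entH
    simp_rw [aux_joint μ A B U_A U_B hunifA hunifB hindep]
    rw [tsum_eq_sum (s := A ×ˢ B) (fun x hx => by simp only [if_neg hx]; simp),
      Finset.sum_congr rfl (fun x hx => by rw [if_pos hx])]
    rw [Finset.sum_const, Finset.card_product, nsmul_eq_mul, ← hN, Real.logb_inv]
    push_cast
    rw [← hN]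
    field_simp
  have hrpos : ∀ s ∈ A + B, 0 < r s := by
    intro s hs
    obtain ⟨a, h1, b, h2, rfl⟩ := Finset.mem_add.1 hs
    exact Finset.card_pos.2 ⟨(a, b), by simp [h1, h2]⟩
  have hr0 : ∀ s ∉ A + B, r s = 0 := by
    intro s hs
    rw [hr]
    refine Finset.card_eq_zero.2 (Finset.filter_eq_empty_iff.2 ?_)
    rintro ⟨a, b⟩ hx rfl
    rw [Finset.mem_product] at hx
    exact hs (Finset.add_mem_add hx.1 hx.2)
  have hsum : ∑ s ∈ A + B, (r s : ℝ) = N := by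
    rw [hN, ← Nat.cast_mul, ← Finset.card_product, ← Nat.cast_sum]
    congr 1
    refine (Finset.card_eq_sum_card_fiberwise ?_).symm
    rintro ⟨a, b⟩ hx
    have hx := Finset.mem_product.1 (Finset.mem_coe.1 hx)
    exact Finset.mem_coe.2 (Finset.add_mem_add hx.1 hx.2)
  have hs : entH μ (fun ω => U_A ω + U_B ω) =
      - ∑ s ∈ A + B, (r s / N) * Real.logb 2 (r s / N) := by
    unfold entH
    simp_rw [aux_sum μ A B hA hB U_A U_B hmA hmB hunifA hunifB hindep]
    rw [tsum_eq_sum (s := A + B) (fun x hx => by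
      have := hr0 x hx
      simp only [hr] at this
      simp [this]), Finset.sum_neg_distrib]
  have hw : ∀ s ∈ A + B, 0 < (r s : ℝ) / N := fun s h =>
    div_pos (by exact_mod_cast hrpos s h) hN0
  have hw1 : ∑ s ∈ A + B, (r s : ℝ) / N = 1 := by
    rw [← Finset.sum_div, hsum, div_self hN0.ne']
  have hE : (addEnergy A B : ℝ) = ∑ s ∈ A + B, (r s : ℝ) ^ 2 := by
    have : addEnergy A B = Finset.addEnergy A B := rfl
    rw [this, Finset.addEnergy_eq_sum_sq']
    push_cast
    rfl
  have hc : (0:ℝ) < (A + B).card := by exact_mod_cast (hA.add hB).card_pos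
  have hE0 : 0 < (addEnergy A B : ℝ) := by
    rw [hE]
    exact Finset.sum_pos (fun s h => pow_pos (by exact_mod_cast hrpos s h) 2) (hA.add hB)
  rw [hj, hs]
  constructor
  · have h := aux_jensen (A + B) (fun s => (r s : ℝ) / N) (fun s => ((r s : ℝ) / N)⁻¹) hw hw1
      (fun s h => inv_pos.2 (hw s h))
    rw [Finset.sum_congr (g := fun _ => (1:ℝ)) rfl
      (fun s h => mul_inv_cancel₀ (hw s h).ne')] at h
    simp only [Real.logb_inv, mul_neg, Finset.sum_neg_distrib, Finset.sum_const, nsmul_eq_mul,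
      mul_one] at h
    rw [← mul_pow, ← hN, Real.logb_div (pow_pos hN0 2).ne' hc.ne', Real.logb_pow]
    push_cast
    linarith
  · have h := aux_jensen (A + B) (fun s => (r s : ℝ) / N) (fun s => (r s : ℝ) / N) hw hw1 hw
    have e : ∑ s ∈ A + B, (r s : ℝ) / N * ((r s : ℝ) / N) = addEnergy A B / N ^ 2 := by
      rw [hE, Finset.sum_div]
      exact Finset.sum_congr rfl (fun s _ => by ring)
    rw [e, Real.logb_div hE0.ne' (pow_pos hN0 2).ne', Real.logb_pow] at h
    push_cast at h
    linarith
end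

section
/- Let X and Y be discrete random variables taking values in the same abelian group, with finite entropies. Let (X₁, Y₁) and (X₂, Y₂) be conditionally independent trials of (X,Y) relative to X+Y. Then max(H{X₁ − X₂}, H{X₁ − Y₂}) ≤ 2·H{X} + 2·H{Y} − A{X,Y}. -/
open MeasureTheory ProbabilityTheory Real

section Helpers

variable {Ω : Type*} [MeasurableSpace Ω]

/-- Surprisal (pointwise information) of `X`. -/
noncomputable def surp {S : Type*} (μ : Measure Ω) (X : Ω → S) (ω : Ω) : ℝ :=
  -Real.logb 2 (μ (X ⁻¹' {X ω})).toReal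

lemma surp_nonneg {S : Type*} (μ : Measure Ω) [IsProbabilityMeasure μ] (X : Ω → S) (ω : Ω) :
    0 ≤ surp μ X ω := by
  unfold surp
  rw [neg_nonneg]
  apply Real.logb_nonpos (by norm_num) ENNReal.toReal_nonneg
  exact ENNReal.toReal_mono (by simp) (prob_le_one (μ := μ))

lemma surp_measurable {S : Type*} [Countable S] [MeasurableSpace S] [MeasurableSingletonClass S]
    (μ : Measure Ω) {X : Ω → S} (hX : Measurable X) : Measurable (surp μ X) :=
  (measurable_of_countable (fun s : S => -Real.logb 2 (μ (X ⁻¹' {s})).toReal)).comp hX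

lemma lintegral_comp_disc {S : Type*} [Countable S] [MeasurableSpace S]
    [MeasurableSingletonClass S] (μ : Measure Ω) {X : Ω → S} (hX : Measurable X)
    (f : S → ENNReal) : ∫⁻ ω, f (X ω) ∂μ = ∑' s, f s * μ (X ⁻¹' {s}) := by
  rw [← lintegral_map (measurable_of_countable f) hX, lintegral_countable']
  congr 1; ext s
  rw [Measure.map_apply hX (measurableSet_singleton s)]

lemma lint_surp {S : Type*} [Countable S] [MeasurableSpace S] [MeasurableSingletonClass S]
    (μ : Measure Ω) [IsProbabilityMeasure μ] {X : Ω → S} (hX : Measurable X) :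
    ∫⁻ ω, ENNReal.ofReal (surp μ X ω) ∂μ =
      ∑' s, ENNReal.ofReal (-((μ (X ⁻¹' {s})).toReal * Real.logb 2 (μ (X ⁻¹' {s})).toReal)) := by
  have := lintegral_comp_disc μ hX
    (fun s : S => ENNReal.ofReal (-Real.logb 2 (μ (X ⁻¹' {s})).toReal))
  unfold surp
  rw [this]
  congr 1; ext s
  conv_lhs => rw [← ENNReal.ofReal_toReal (measure_ne_top μ (X ⁻¹' {s}))]
  rw [← ENNReal.ofReal_mul' ENNReal.toReal_nonneg]
  congr 1
  simp only [ENNReal.toReal_ofReal ENNReal.toReal_nonneg]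
  ring

lemma entH_term_nonneg {S : Type*} (μ : Measure Ω) [IsProbabilityMeasure μ] (X : Ω → S) (s : S) :
    0 ≤ -((μ (X ⁻¹' {s})).toReal * Real.logb 2 (μ (X ⁻¹' {s})).toReal) := by
  rw [neg_nonneg]
  apply mul_nonpos_of_nonneg_of_nonpos ENNReal.toReal_nonneg
  apply Real.logb_nonpos (by norm_num) ENNReal.toReal_nonneg
  exact ENNReal.toReal_mono (by simp) (prob_le_one (μ := μ))

lemma entH_eq_integral {S : Type*} [Countable S] [MeasurableSpace S] [MeasurableSingletonClass S]
    (μ : Measure Ω) [IsProbabilityMeasure μ] {X : Ω → S} (hX : Measurable X) :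
    entH μ X = ∫ ω, surp μ X ω ∂μ := by
  rw [integral_eq_lintegral_of_nonneg_ae (Filter.Eventually.of_forall (surp_nonneg μ X))
    (surp_measurable μ hX).aestronglyMeasurable, lint_surp μ hX, ENNReal.tsum_toReal_eq (by simp)]
  unfold entH
  congr 1; ext s
  rw [ENNReal.toReal_ofReal (entH_term_nonneg μ X s)]

lemma integrable_surp {S : Type*} [Countable S] [MeasurableSpace S] [MeasurableSingletonClass S]
    (μ : Measure Ω) [IsProbabilityMeasure μ] {X : Ω → S} (hX : Measurable X)
    (hf : FinEnt μ X) : Integrable (surp μ X) μ := by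
  refine ⟨(surp_measurable μ hX).aestronglyMeasurable, ?_⟩
  rw [hasFiniteIntegral_iff_ofReal (Filter.Eventually.of_forall (surp_nonneg μ X)),
    lint_surp μ hX, ← ENNReal.ofReal_tsum_of_nonneg (entH_term_nonneg μ X) hf]
  exact ENNReal.ofReal_lt_top

lemma ae_pos {S : Type*} [Countable S] (μ : Measure Ω) (X : Ω → S) :
    ∀ᵐ ω ∂μ, μ (X ⁻¹' {X ω}) ≠ 0 := by
  rw [ae_iff]
  have : {ω | ¬ μ (X ⁻¹' {X ω}) ≠ 0} ⊆ ⋃ s ∈ {s : S | μ (X ⁻¹' {s}) = 0}, X ⁻¹' {s} := by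
    intro ω hω
    simp only [Set.mem_iUnion]
    exact ⟨X ω, by simpa using hω, rfl⟩
  refine measure_mono_null this ?_
  rw [measure_biUnion_null_iff (Set.to_countable _)]
  intro s hs; exact hs

/-- Data processing, pointwise. -/
lemma surp_le {S T : Type*} [Countable S] [Countable T] (μ : Measure Ω) [IsProbabilityMeasure μ]
    {X : Ω → S} {W : Ω → T} (g : T → S) (h : ∀ᵐ ω ∂μ, X ω = g (W ω)) :
    ∀ᵐ ω ∂μ, surp μ X ω ≤ surp μ W ω := by
  filter_upwards [h, ae_pos μ W] with ω hω hp
  unfold surp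
  have hle : μ (W ⁻¹' {W ω}) ≤ μ (X ⁻¹' {X ω}) := by
    apply measure_mono_ae
    filter_upwards [h] with ω' hω' (hw : W ω' = W ω)
    show X ω' = X ω
    rw [hω', hω, hw]
  rw [neg_le_neg_iff]
  apply Real.logb_le_logb_of_le (by norm_num) (ENNReal.toReal_pos hp (by simp))
  exact ENNReal.toReal_mono (by simp) hle

lemma surp_congr {S T : Type*} [Countable S] [Countable T] (μ : Measure Ω)
    [IsProbabilityMeasure μ]
    {X : Ω → S} {W : Ω → T} (g : T → S) (h : ∀ᵐ ω ∂μ, X ω = g (W ω))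
    (g' : S → T) (h' : ∀ᵐ ω ∂μ, W ω = g' (X ω)) :
    surp μ X =ᵐ[μ] surp μ W := by
  filter_upwards [surp_le μ g h, surp_le μ g' h'] with ω h1 h2 using le_antisymm h1 h2

lemma tsum_joint {S T : Type*} [Countable S] [MeasurableSpace S] [MeasurableSingletonClass S]
    [Countable T] [MeasurableSpace T] [MeasurableSingletonClass T]
    (μ : Measure Ω) {D : Ω → T} {A : Ω → S} (hA : Measurable A) (d : T) :
    ∑' a, μ ((fun ω => (D ω, A ω)) ⁻¹' {(d, a)}) = μ (D ⁻¹' {d}) := by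
  have := lintegral_comp_disc (μ.restrict (D ⁻¹' {d})) hA (fun _ => 1)
  simp only [lintegral_const, one_mul, Measure.restrict_apply MeasurableSet.univ,
    Set.univ_inter] at this
  rw [this]
  congr 1; ext a
  rw [Measure.restrict_apply (hA (measurableSet_singleton a))]
  congr 1; ext ω; simp [and_comm]

lemma submod {S T U : Type*} [Countable S] [MeasurableSpace S] [MeasurableSingletonClass S]
    [Countable T] [MeasurableSpace T] [MeasurableSingletonClass T]
    [Countable U] [MeasurableSpace U] [MeasurableSingletonClass U]
    (μ : Measure Ω) [IsProbabilityMeasure μ] {D : Ω → T} {A : Ω → S} {B : Ω → U}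
    (hD : Measurable D) (hA : Measurable A) (hB : Measurable B)
    (iA : Integrable (surp μ (fun ω => (D ω, A ω))) μ)
    (iB : Integrable (surp μ (fun ω => (D ω, B ω))) μ) :
    Integrable (surp μ D) μ ∧ Integrable (surp μ (fun ω => (D ω, A ω, B ω))) μ ∧
    ∫ ω, surp μ (fun ω => (D ω, A ω, B ω)) ω ∂μ + ∫ ω, surp μ D ω ∂μ ≤
      ∫ ω, surp μ (fun ω => (D ω, A ω)) ω ∂μ + ∫ ω, surp μ (fun ω => (D ω, B ω)) ω ∂μ := by
  set W := fun ω => (D ω, A ω, B ω) with hW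
  have mW : Measurable W := hD.prodMk (hA.prodMk hB)
  let R : T × S × U → ENNReal := fun s =>
    μ ((fun ω => (D ω, A ω)) ⁻¹' {(s.1, s.2.1)}) * μ ((fun ω => (D ω, B ω)) ⁻¹' {(s.1, s.2.2)})
      / μ (D ⁻¹' {s.1}) / μ (W ⁻¹' {s})
  have hR : ∫⁻ ω, R (W ω) ∂μ ≤ 1 := by
    rw [lintegral_comp_disc μ mW R]
    calc ∑' s, R s * μ (W ⁻¹' {s}) ≤ ∑' s : T × S × U,
          μ ((fun ω => (D ω, A ω)) ⁻¹' {(s.1, s.2.1)}) *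
          μ ((fun ω => (D ω, B ω)) ⁻¹' {(s.1, s.2.2)}) / μ (D ⁻¹' {s.1}) := by
          apply ENNReal.tsum_le_tsum
          intro s
          rw [mul_comm]
          exact ENNReal.mul_div_le
      _ = ∑' d, μ (D ⁻¹' {d}) * μ (D ⁻¹' {d}) / μ (D ⁻¹' {d}) := by
          rw [ENNReal.tsum_prod']
          congr 1; ext d
          rw [ENNReal.tsum_prod']
          simp only [div_eq_mul_inv, ENNReal.tsum_mul_right, ENNReal.tsum_mul_left]
          rw [tsum_joint μ hA, tsum_joint μ hB]
      _ ≤ ∑' d, 1 * μ (D ⁻¹' {d}) := by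
          apply ENNReal.tsum_le_tsum
          intro d
          rw [one_mul, mul_div_assoc]
          exact ENNReal.mul_div_le
      _ = 1 := by
          rw [← lintegral_comp_disc μ hD (fun _ => 1)]; simp
  have mR : Measurable (fun ω => R (W ω)) := (measurable_of_countable R).comp mW
  have iR : Integrable (fun ω => (R (W ω)).toReal) μ :=
    integrable_toReal_of_lintegral_ne_top mR.aemeasurable (ne_top_of_le_ne_top (by simp) hR)
  have hRint : ∫ ω, (R (W ω)).toReal ∂μ ≤ 1 := by
    rw [integral_toReal mR.aemeasurable
      (ae_lt_top mR (ne_top_of_le_ne_top (by simp) hR))]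
    exact ENNReal.toReal_mono (by simp) hR
  have hDA := surp_le (X := D) (W := fun ω => (D ω, A ω)) μ Prod.fst (by simp)
  have iD : Integrable (surp μ D) μ := by
    refine iA.mono' (surp_measurable μ hD).aestronglyMeasurable ?_
    filter_upwards [hDA] with ω h
    rwa [Real.norm_of_nonneg (surp_nonneg μ _ _)]
  have hl2 : 0 < Real.log 2 := Real.log_pos (by norm_num)
  have key : ∀ᵐ ω ∂μ, surp μ W ω + surp μ D ω ≤ surp μ (fun ω => (D ω, A ω)) ω +
      surp μ (fun ω => (D ω, B ω)) ω + ((R (W ω)).toReal - 1) / Real.log 2 := by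
    filter_upwards [ae_pos μ W, ae_pos μ D, ae_pos μ (fun ω => (D ω, A ω)),
      ae_pos μ (fun ω => (D ω, B ω))] with ω h1 h2 h3 h4
    have e : (R (W ω)).toReal = (μ ((fun ω => (D ω, A ω)) ⁻¹' {(D ω, A ω)})).toReal *
      (μ ((fun ω => (D ω, B ω)) ⁻¹' {(D ω, B ω)})).toReal / (μ (D ⁻¹' {D ω})).toReal /
        (μ (W ⁻¹' {W ω})).toReal := by
      simp only [R, ENNReal.toReal_div, ENNReal.toReal_mul, hW]
    unfold surp
    have p1 := ENNReal.toReal_pos h1 (measure_ne_top μ _)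
    have p2 := ENNReal.toReal_pos h2 (measure_ne_top μ _)
    have p3 := ENNReal.toReal_pos h3 (measure_ne_top μ _)
    have p4 := ENNReal.toReal_pos h4 (measure_ne_top μ _)
    have hlog := Real.log_le_sub_one_of_pos (x := (R (W ω)).toReal) (by rw [e]; positivity)
    have : Real.log (R (W ω)).toReal / Real.log 2 ≤ ((R (W ω)).toReal - 1) / Real.log 2 := by
      gcongr
    rw [e, Real.log_div (by positivity) p1.ne', Real.log_div (by positivity) p2.ne',
      Real.log_mul p3.ne' p4.ne', sub_div, sub_div, add_div, ← e] at this
    simp only [Real.logb]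
    linarith
  have iRHS : Integrable (fun ω => surp μ (fun ω => (D ω, A ω)) ω +
      surp μ (fun ω => (D ω, B ω)) ω + ((R (W ω)).toReal - 1) / Real.log 2) μ :=
    (iA.add iB).add ((iR.sub (integrable_const 1)).div_const _)
  have iW : Integrable (surp μ W) μ := by
    refine iRHS.mono' (surp_measurable μ mW).aestronglyMeasurable ?_
    filter_upwards [key] with ω h
    rw [Real.norm_of_nonneg (surp_nonneg μ _ _)]
    linarith [surp_nonneg μ D ω]
  refine ⟨iD, iW, ?_⟩
  have := integral_mono_ae (iW.add iD) iRHS key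
  simp only [Pi.add_apply] at this
  have iAB : Integrable (fun ω => surp μ (fun ω => (D ω, A ω)) ω +
      surp μ (fun ω => (D ω, B ω)) ω) μ := iA.add iB
  have iR' : Integrable (fun ω => ((R (W ω)).toReal - 1) / Real.log 2) μ :=
    (iR.sub (integrable_const 1)).div_const _
  rw [integral_add iW iD, integral_add iAB iR',
    integral_add iA iB, integral_div, integral_sub iR (integrable_const 1)] at this
  have h0 : (∫ ω, (R (W ω)).toReal ∂μ - ∫ _, (1:ℝ) ∂μ) / Real.log 2 ≤ 0 := by
    apply div_nonpos_of_nonpos_of_nonneg _ hl2.le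
    simp; exact hRint
  linarith

lemma subadd {S U : Type*} [Countable S] [MeasurableSpace S] [MeasurableSingletonClass S]
    [Countable U] [MeasurableSpace U] [MeasurableSingletonClass U]
    (μ : Measure Ω) [IsProbabilityMeasure μ] {A : Ω → S} {B : Ω → U}
    (hA : Measurable A) (hB : Measurable B)
    (iA : Integrable (surp μ A) μ) (iB : Integrable (surp μ B) μ) :
    Integrable (surp μ (fun ω => (A ω, B ω))) μ ∧
    ∫ ω, surp μ (fun ω => (A ω, B ω)) ω ∂μ ≤ ∫ ω, surp μ A ω ∂μ + ∫ ω, surp μ B ω ∂μ := by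
  have eA := surp_congr (X := A) (W := fun ω => ((), A ω)) μ Prod.snd (by simp)
    (fun a => ((), a)) (by simp)
  have eB := surp_congr (X := B) (W := fun ω => ((), B ω)) μ Prod.snd (by simp)
    (fun a => ((), a)) (by simp)
  have eAB := surp_congr (X := fun ω => (A ω, B ω)) (W := fun ω => ((), A ω, B ω)) μ Prod.snd
    (by simp) (fun a => ((), a)) (by simp)
  obtain ⟨-, h2, h3⟩ := submod μ (D := fun _ => ()) measurable_const hA hB
    ((integrable_congr eA).1 iA) ((integrable_congr eB).1 iB)
  refine ⟨(integrable_congr eAB).2 h2, ?_⟩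
  rw [integral_congr_ae eA, integral_congr_ae eB, integral_congr_ae eAB]
  have : 0 ≤ ∫ ω, surp μ (fun _ => ()) ω ∂μ := integral_nonneg (surp_nonneg μ _)
  linarith

/-- The combinatorial core: `D` is determined by `(U, V)` and by `(U', V')`. -/
lemma core {G Q : Type*} [Countable G] [MeasurableSpace G] [MeasurableSingletonClass G]
    [Countable Q] [MeasurableSpace Q] [MeasurableSingletonClass Q]
    (μ : Measure Ω) [IsProbabilityMeasure μ] {A B D V V' : Ω → G} {W : Ω → Q}
    (hA : Measurable A) (hB : Measurable B) (hD : Measurable D) (hV : Measurable V)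
    (hV' : Measurable V')
    (iA : Integrable (surp μ A) μ) (iB : Integrable (surp μ B) μ)
    (iV : Integrable (surp μ V) μ) (iV' : Integrable (surp μ V') μ)
    (f f' : G × G → G) (hf : ∀ᵐ ω ∂μ, D ω = f (A ω, V ω)) (hf' : ∀ᵐ ω ∂μ, D ω = f' (B ω, V' ω))
    (g : G × G × G → Q) (hg : ∀ᵐ ω ∂μ, W ω = g (D ω, A ω, B ω))
    (mW : Measurable W) :
    ∫ ω, surp μ D ω ∂μ ≤ ∫ ω, surp μ A ω ∂μ + ∫ ω, surp μ B ω ∂μ + ∫ ω, surp μ V ω ∂μ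
      + ∫ ω, surp μ V' ω ∂μ - ∫ ω, surp μ W ω ∂μ := by
  obtain ⟨i1, l1⟩ := subadd μ hA hV iA iV
  obtain ⟨i2, l2⟩ := subadd μ hB hV' iB iV'
  have k1 := surp_le (X := fun ω => (D ω, A ω)) (W := fun ω => (A ω, V ω)) μ
    (fun p => (f p, p.1)) (by filter_upwards [hf] with ω h; rw [h])
  have k2 := surp_le (X := fun ω => (D ω, B ω)) (W := fun ω => (B ω, V' ω)) μ
    (fun p => (f' p, p.1)) (by filter_upwards [hf'] with ω h; rw [h])
  have k3 := surp_le μ g hg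
  have j1 : Integrable (surp μ (fun ω => (D ω, A ω))) μ := by
    refine i1.mono' (surp_measurable μ (hD.prodMk hA)).aestronglyMeasurable ?_
    filter_upwards [k1] with ω h
    rwa [Real.norm_of_nonneg (surp_nonneg μ _ _)]
  have j2 : Integrable (surp μ (fun ω => (D ω, B ω))) μ := by
    refine i2.mono' (surp_measurable μ (hD.prodMk hB)).aestronglyMeasurable ?_
    filter_upwards [k2] with ω h
    rwa [Real.norm_of_nonneg (surp_nonneg μ _ _)]
  obtain ⟨-, j3, l3⟩ := submod μ hD hA hB j1 j2
  have j4 : Integrable (surp μ W) μ := by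
    refine j3.mono' (surp_measurable μ mW).aestronglyMeasurable ?_
    filter_upwards [k3] with ω h
    rwa [Real.norm_of_nonneg (surp_nonneg μ _ _)]
  have m1 := integral_mono_ae j1 i1 k1
  have m2 := integral_mono_ae j2 i2 k2
  have m3 := integral_mono_ae j4 j3 k3
  linarith

lemma entH_congr_law {S : Type*} [Countable S] [MeasurableSpace S] [MeasurableSingletonClass S]
    (μ : Measure Ω) {X X' : Ω → S} (hX : Measurable X) (hX' : Measurable X')
    (h : Measure.map X μ = Measure.map X' μ) :
    entH μ X = entH μ X' ∧ (FinEnt μ X ↔ FinEnt μ X') := by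
  have : ∀ s, μ (X ⁻¹' {s}) = μ (X' ⁻¹' {s}) := fun s => by
    rw [← Measure.map_apply hX (measurableSet_singleton s), h,
      Measure.map_apply hX' (measurableSet_singleton s)]
  simp only [entH, FinEnt, this, and_self]

lemma cond_eq_of_sub {T G : Type*} [Countable T] [MeasurableSpace T] [MeasurableSingletonClass T]
    [MeasurableSpace G] [MeasurableSingletonClass G]
    (μ : Measure Ω) {Z : Ω → G} (hZ : Measurable Z) {W : Ω → T} (s : T → G)
    (h : ∀ᵐ ω ∂μ, s (W ω) = Z ω) (a : T) :
    μ[|Z ⁻¹' {s a}] (W ⁻¹' {a}) = (μ (Z ⁻¹' {s a}))⁻¹ * μ (W ⁻¹' {a}) := by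
  rw [cond_apply (hZ (measurableSet_singleton _))]
  congr 1
  apply measure_congr
  filter_upwards [h] with ω hω
  apply propext
  show (Z ω = s a ∧ W ω = a) ↔ W ω = a
  constructor
  · exact fun h => h.2
  · exact fun h => ⟨by rw [← hω, h], h⟩

lemma law_eq {T G : Type*} [Countable T] [MeasurableSpace T] [MeasurableSingletonClass T]
    [MeasurableSpace G] [MeasurableSingletonClass G]
    (μ : Measure Ω) [IsProbabilityMeasure μ] {Z : Ω → G} (hZ : Measurable Z) {W W' : Ω → T}
    (mW : Measurable W) (mW' : Measurable W')
    (s : T → G)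
    (h : ∀ᵐ ω ∂μ, s (W ω) = Z ω) (h' : ∀ᵐ ω ∂μ, s (W' ω) = Z ω)
    (hc : ∀ z, μ (Z ⁻¹' {z}) ≠ 0 → Measure.map W (μ[|Z ⁻¹' {z}]) = Measure.map W' (μ[|Z ⁻¹' {z}])) :
    Measure.map W μ = Measure.map W' μ := by
  apply Measure.ext_of_singleton
  intro a
  rw [Measure.map_apply mW (measurableSet_singleton a),
    Measure.map_apply mW' (measurableSet_singleton a)]
  by_cases h0 : μ (Z ⁻¹' {s a}) = 0
  · have aux : ∀ V : Ω → T, (∀ᵐ ω ∂μ, s (V ω) = Z ω) → μ (V ⁻¹' {a}) = 0 := by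
      intro V hV
      refine le_antisymm (le_trans (measure_mono_ae ?_) h0.le) bot_le
      filter_upwards [hV] with ω hω (hv : V ω = a)
      show Z ω = s a
      rw [← hω, hv]
    rw [aux W h, aux W' h']
  · have e := congrArg (fun ν => ν {a}) (hc (s a) h0)
    simp only [Measure.map_apply mW (measurableSet_singleton a),
      Measure.map_apply mW' (measurableSet_singleton a), cond_eq_of_sub μ hZ s h a,
      cond_eq_of_sub μ hZ s h' a] at e
    exact (ENNReal.mul_right_inj (by simp) (by simpa using h0)).1 e

lemma surp_trials {T G : Type*} [Countable T] [MeasurableSpace T] [MeasurableSingletonClass T]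
    [Countable G] [MeasurableSpace G] [MeasurableSingletonClass G]
    (μ : Measure Ω) [IsProbabilityMeasure μ] {Z : Ω → G} (hZ : Measurable Z) {W W' : Ω → T}
    (s : T → G)
    (h : ∀ᵐ ω ∂μ, s (W ω) = Z ω) (h' : ∀ᵐ ω ∂μ, s (W' ω) = Z ω)
    (hc : ∀ z, μ (Z ⁻¹' {z}) ≠ 0 → IndepFun W W' (μ[|Z ⁻¹' {z}])) :
    surp μ (fun ω => (W ω, W' ω)) =ᵐ[μ] fun ω => surp μ W ω + surp μ W' ω - surp μ Z ω := by
  filter_upwards [h, h', ae_pos μ Z, ae_pos μ W, ae_pos μ W'] with ω h1 h2 p0 p1 p2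
  have hi := indepFun_iff_measure_inter_preimage_eq_mul.1 (hc (Z ω) p0) {W ω} {W' ω}
    (measurableSet_singleton _) (measurableSet_singleton _)
  have e1 := cond_eq_of_sub μ hZ s h (W ω)
  have e2 := cond_eq_of_sub μ hZ s h' (W' ω)
  have e3 := cond_eq_of_sub μ hZ (fun p : T × T => s p.1) (W := fun ω => (W ω, W' ω)) h
    (W ω, W' ω)
  simp only at e3
  rw [h1] at e1 e3
  rw [h2] at e2
  have e4 : W ⁻¹' {W ω} ∩ W' ⁻¹' {W' ω} = (fun ω => (W ω, W' ω)) ⁻¹' {(W ω, W' ω)} := by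
    ext; simp
  rw [e4, e1, e2, e3] at hi
  have q0 := ENNReal.toReal_pos p0 (measure_ne_top μ _)
  have q1 := ENNReal.toReal_pos p1 (measure_ne_top μ _)
  have q2 := ENNReal.toReal_pos p2 (measure_ne_top μ _)
  have hr := congrArg ENNReal.toReal hi
  simp only [ENNReal.toReal_mul, ENNReal.toReal_inv] at hr
  have hr' : (μ ((fun ω => (W ω, W' ω)) ⁻¹' {(W ω, W' ω)})).toReal =
      (μ (W ⁻¹' {W ω})).toReal * (μ (W' ⁻¹' {W' ω})).toReal / (μ (Z ⁻¹' {Z ω})).toReal := by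
    field_simp at hr ⊢
    linarith
  unfold surp
  rw [hr', Real.logb_div (by positivity) (by positivity), Real.logb_mul q1.ne' q2.ne']
  ring

end Helpers

/-- Entropic Balog–Szemerédi–Gowers lemma: if `(X₁, Y₁)` and `(X₂, Y₂)` are conditionally
independent trials of `(X,Y)` relative to `X+Y`, then
`max(H{X₁ − X₂}, H{X₁ − Y₂}) ≤ 2·H{X} + 2·H{Y} − 𝐀{X,Y}`,
where `𝐀{X,Y} = 2·H{X,Y} − H{X+Y}`. -/
theorem stmt6 {Ω G : Type*} [MeasurableSpace Ω] [AddCommGroup G] [Countable G]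
    [MeasurableSpace G] [MeasurableSingletonClass G]
    (μ : Measure Ω) [IsProbabilityMeasure μ]
    (X Y X₁ Y₁ X₂ Y₂ : Ω → G)
    (hmX : Measurable X) (hmY : Measurable Y) (hmX₁ : Measurable X₁)
    (hmY₁ : Measurable Y₁) (hmX₂ : Measurable X₂) (hmY₂ : Measurable Y₂)
    (hfX : FinEnt μ X) (hfY : FinEnt μ Y)
    (hfXY : FinEnt μ (fun ω => (X ω, Y ω)))
    -- the trials sum to `X + Y`:
    (hsum1 : ∀ᵐ ω ∂μ, X₁ ω + Y₁ ω = X ω + Y ω)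
    (hsum2 : ∀ᵐ ω ∂μ, X₂ ω + Y₂ ω = X ω + Y ω)
    -- conditionally on each value of `X+Y`, the trials `(X₁,Y₁)` and `(X₂,Y₂)` are
    -- independent and each is distributed as `(X,Y)`:
    (htrials : ∀ z : G, μ ((fun ω => X ω + Y ω) ⁻¹' {z}) ≠ 0 →
      IndepFun (fun ω => (X₁ ω, Y₁ ω)) (fun ω => (X₂ ω, Y₂ ω))
          (μ[|(fun ω => X ω + Y ω) ⁻¹' {z}]) ∧
        Measure.map (fun ω => (X₁ ω, Y₁ ω)) (μ[|(fun ω => X ω + Y ω) ⁻¹' {z}]) =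
          Measure.map (fun ω => (X ω, Y ω)) (μ[|(fun ω => X ω + Y ω) ⁻¹' {z}]) ∧
        Measure.map (fun ω => (X₂ ω, Y₂ ω)) (μ[|(fun ω => X ω + Y ω) ⁻¹' {z}]) =
          Measure.map (fun ω => (X ω, Y ω)) (μ[|(fun ω => X ω + Y ω) ⁻¹' {z}])) :
    max (entH μ (fun ω => X₁ ω - X₂ ω)) (entH μ (fun ω => X₁ ω - Y₂ ω))
      ≤ 2 * entH μ X + 2 * entH μ Y
        - (2 * entH μ (fun ω => (X ω, Y ω)) - entH μ (fun ω => X ω + Y ω)) := by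
  have hZ : Measurable (fun ω => X ω + Y ω) :=
    (measurable_of_countable (fun p : G × G => p.1 + p.2)).comp (hmX.prodMk hmY)
  have m0 : Measurable (fun ω => (X ω, Y ω)) := hmX.prodMk hmY
  have m1 : Measurable (fun ω => (X₁ ω, Y₁ ω)) := hmX₁.prodMk hmY₁
  have m2 : Measurable (fun ω => (X₂ ω, Y₂ ω)) := hmX₂.prodMk hmY₂
  have law1 := law_eq μ hZ m1 m0 (fun p : G × G => p.1 + p.2) hsum1 (by simp)
    (fun z hz => (htrials z hz).2.1)
  have law2 := law_eq μ hZ m2 m0 (fun p : G × G => p.1 + p.2) hsum2 (by simp)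
    (fun z hz => (htrials z hz).2.2)
  have marg : ∀ {P Q : Ω → G}, Measurable P → Measurable Q →
      Measure.map (fun ω => (P ω, Q ω)) μ = Measure.map (fun ω => (X ω, Y ω)) μ →
      Measure.map P μ = Measure.map X μ ∧ Measure.map Q μ = Measure.map Y μ := by
    intro P Q hP hQ h
    have a := congrArg (Measure.map Prod.fst) h
    have b := congrArg (Measure.map Prod.snd) h
    rw [Measure.map_map measurable_fst (hP.prodMk hQ), Measure.map_map measurable_fst m0] at a
    rw [Measure.map_map measurable_snd (hP.prodMk hQ), Measure.map_map measurable_snd m0] at b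
    exact ⟨a, b⟩
  obtain ⟨lX1, lY1⟩ := marg hmX₁ hmY₁ law1
  obtain ⟨lX2, lY2⟩ := marg hmX₂ hmY₂ law2
  obtain ⟨e1, f1⟩ := entH_congr_law μ m1 m0 law1
  obtain ⟨e2, f2⟩ := entH_congr_law μ m2 m0 law2
  obtain ⟨eX1, fX1⟩ := entH_congr_law μ hmX₁ hmX lX1
  obtain ⟨eX2, fX2⟩ := entH_congr_law μ hmX₂ hmX lX2
  obtain ⟨eY1, fY1⟩ := entH_congr_law μ hmY₁ hmY lY1
  obtain ⟨eY2, fY2⟩ := entH_congr_law μ hmY₂ hmY lY2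
  have i1 := integrable_surp μ m1 (f1.2 hfXY)
  have i2 := integrable_surp μ m2 (f2.2 hfXY)
  have i0 := integrable_surp μ m0 hfXY
  have iX1 := integrable_surp μ hmX₁ (fX1.2 hfX)
  have iX2 := integrable_surp μ hmX₂ (fX2.2 hfX)
  have iY1 := integrable_surp μ hmY₁ (fY1.2 hfY)
  have iY2 := integrable_surp μ hmY₂ (fY2.2 hfY)
  have iZ : Integrable (surp μ (fun ω => X ω + Y ω)) μ := by
    refine i0.mono' (surp_measurable μ hZ).aestronglyMeasurable ?_
    filter_upwards [surp_le (X := fun ω => X ω + Y ω) (W := fun ω => (X ω, Y ω)) μ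
      (fun p => p.1 + p.2) (by simp)] with ω h
    rwa [Real.norm_of_nonneg (surp_nonneg μ _ _)]
  have hW := integral_congr_ae (surp_trials μ hZ (fun p : G × G => p.1 + p.2) hsum1 hsum2
    (fun z hz => (htrials z hz).1))
  have i12 : Integrable (fun ω => surp μ (fun ω => (X₁ ω, Y₁ ω)) ω +
    surp μ (fun ω => (X₂ ω, Y₂ ω)) ω) μ := i1.add i2
  rw [integral_sub i12 iZ, integral_add i1 i2, ← entH_eq_integral μ m1,
    ← entH_eq_integral μ m2, ← entH_eq_integral μ hZ, e1, e2] at hW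
  have mDX : Measurable (fun ω => X₁ ω - X₂ ω) :=
    (measurable_of_countable (fun p : G × G => p.1 - p.2)).comp (hmX₁.prodMk hmX₂)
  have mDY : Measurable (fun ω => X₁ ω - Y₂ ω) :=
    (measurable_of_countable (fun p : G × G => p.1 - p.2)).comp (hmX₁.prodMk hmY₂)
  have c1 := core μ hmX₁ hmY₁ mDX hmX₂ hmY₂ iX1 iY1 iX2 iY2 (fun p => p.1 - p.2)
    (fun p => p.2 - p.1) (by simp)
    (by
      filter_upwards [hsum1, hsum2] with ω h1 h2
      rw [sub_eq_sub_iff_add_eq_add, h1, ← h2, add_comm])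
    (W := fun ω => ((X₁ ω, Y₁ ω), (X₂ ω, Y₂ ω)))
    (fun t => ((t.2.1, t.2.2), (t.2.1 - t.1, t.2.2 + t.1)))
    (by
      filter_upwards [hsum1, hsum2] with ω h1 h2
      have h3 : Y₂ ω = X₁ ω + Y₁ ω - X₂ ω := by rw [h1, ← h2]; abel
      simp only [Prod.mk.injEq, true_and]
      exact ⟨by abel, by rw [h3]; abel⟩) (m1.prodMk m2)
  have c2 := core μ hmX₁ hmY₁ mDY hmY₂ hmX₂ iX1 iY1 iY2 iX2 (fun p => p.1 - p.2)
    (fun p => p.2 - p.1) (by simp)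
    (by
      filter_upwards [hsum1, hsum2] with ω h1 h2
      rw [sub_eq_sub_iff_add_eq_add, h1, h2])
    (W := fun ω => ((X₁ ω, Y₁ ω), (X₂ ω, Y₂ ω)))
    (fun t => ((t.2.1, t.2.2), (t.2.2 + t.1, t.2.1 - t.1)))
    (by
      filter_upwards [hsum1, hsum2] with ω h1 h2
      have h3 : X₂ ω = X₁ ω + Y₁ ω - Y₂ ω := by rw [h1, ← h2]; abel
      simp only [Prod.mk.injEq, true_and]
      exact ⟨by rw [h3]; abel, by abel⟩) (m1.prodMk m2)
  rw [hW, ← entH_eq_integral μ hmX₁, ← entH_eq_integral μ hmX₂, ← entH_eq_integral μ hmY₁,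
    ← entH_eq_integral μ hmY₂, eX1, eX2, eY1, eY2] at c1 c2
  rw [← entH_eq_integral μ mDX] at c1
  rw [← entH_eq_integral μ mDY] at c2
  apply max_le <;> linarith
end

section
/- Let X and Y be discrete random variables taking values in the same abelian group, with finite entropies, and let C > 0. If A{X,Y} ≥ (3/2)·H{X} + (3/2)·H{Y} − log C, then H{X} − 2 log C ≤ H{Y} ≤ H{X} + 2 log C. -/
open MeasureTheory ProbabilityTheory Real

/-- The entropy function. -/
noncomputable def ef (x : ℝ) : ℝ := -(x * Real.logb 2 x)

lemma ef_nonneg {x : ℝ} (h0 : 0 ≤ x) (h1 : x ≤ 1) : 0 ≤ ef x := by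
  have := Real.logb_nonpos (b := 2) (by norm_num) h0 h1
  unfold ef; nlinarith

lemma ef_marg {S T : Type*} (p : S × T → ℝ) (a : S → ℝ) (hp : ∀ z, 0 ≤ p z)
    (ha : ∀ s, HasSum (fun t => p (s, t)) (a s)) (ha1 : ∀ s, a s ≤ 1)
    (hs : Summable fun z => ef (p z)) : Summable fun s => ef (a s) := by
  have ha0 : ∀ s, 0 ≤ a s := fun s => (ha s).nonneg fun t => hp _
  have hle : ∀ s t, p (s, t) ≤ a s := fun s t => le_hasSum (ha s) t fun j _ => hp _
  refine Summable.of_nonneg_of_le (fun s => ef_nonneg (ha0 s) (ha1 s)) (fun s => ?_) hs.prod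
  have h1 : HasSum (fun t => p (s, t) * (-Real.logb 2 (a s))) (ef (a s)) := by
    have := (ha s).mul_right (-Real.logb 2 (a s))
    simpa [ef] using this
  refine hasSum_le (fun t => ?_) h1 (hs.prod_factor s).hasSum
  rcases (hp (s, t)).eq_or_lt with h | h
  · simp [ef, ← h]
  · have := Real.logb_le_logb_of_le (b := 2) (by norm_num) h (hle s t)
    unfold ef; nlinarith

lemma ef_expand {S T : Type*} (p : S × T → ℝ) (a : S → ℝ) (hp : ∀ z, 0 ≤ p z)
    (ha : ∀ s, HasSum (fun t => p (s, t)) (a s)) (ha1 : ∀ s, a s ≤ 1)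
    (hs : Summable fun s => ef (a s)) :
    HasSum (fun z : S × T => p z * (-Real.logb 2 (a z.1))) (∑' s, ef (a s)) := by
  have ha0 : ∀ s, 0 ≤ a s := fun s => (ha s).nonneg fun t => hp _
  have h1 : ∀ s, HasSum (fun t => p (s, t) * (-Real.logb 2 (a s))) (ef (a s)) := fun s => by
    have := (ha s).mul_right (-Real.logb 2 (a s))
    simpa [ef] using this
  have h2 : Summable (fun z : S × T => p z * (-Real.logb 2 (a z.1))) := by
    rw [summable_prod_of_nonneg]
    · refine ⟨fun s => (h1 s).summable, ?_⟩
      simpa only [(h1 _).tsum_eq] using hs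
    · intro z
      have := Real.logb_nonpos (b := 2) (by norm_num) (ha0 z.1) (ha1 z.1)
      exact mul_nonneg (hp z) (by linarith)
  have h3 := h2.hasSum.prod_fiberwise h1
  rw [h3.tsum_eq]; exact h2.hasSum

lemma ef_subadd {S T : Type*} (p : S × T → ℝ) (a : S → ℝ) (b : T → ℝ) (hp : ∀ z, 0 ≤ p z)
    (ha : ∀ s, HasSum (fun t => p (s, t)) (a s)) (hb : ∀ t, HasSum (fun s => p (s, t)) (b t))
    (ha1 : HasSum a 1) (hb1 : HasSum b 1) (hp1 : HasSum p 1)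
    (hs : Summable fun z => ef (p z)) (hsa : Summable fun s => ef (a s))
    (hsb : Summable fun t => ef (b t)) :
    ∑' z, ef (p z) ≤ ∑' s, ef (a s) + ∑' t, ef (b t) := by
  have ha0 : ∀ s, 0 ≤ a s := fun s => (ha s).nonneg fun t => hp _
  have hb0 : ∀ t, 0 ≤ b t := fun s => (hb s).nonneg fun t => hp _
  have hle : ∀ s t, p (s, t) ≤ a s := fun s t => le_hasSum (ha s) t fun j _ => hp _
  have hle' : ∀ s t, p (s, t) ≤ b t := fun s t => le_hasSum (hb t) s fun j _ => hp _
  have haa : ∀ s, a s ≤ 1 := fun s => le_hasSum ha1 s fun j _ => ha0 _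
  have hbb : ∀ s, b s ≤ 1 := fun s => le_hasSum hb1 s fun j _ => hb0 _
  have h1 := ef_expand p a hp ha haa hsa
  have h2 := ef_expand (fun z : T × S => p z.swap) b (fun z => hp _) hb hbb hsb
  have h2' : HasSum (fun z : S × T => p z * (-Real.logb 2 (b z.2))) (∑' t, ef (b t)) := by
    rw [← (Equiv.prodComm T S).hasSum_iff]
    exact h2
  have hab : HasSum (fun z : S × T => a z.1 * b z.2) (1 * 1) :=
    ha1.mul hb1 (ha1.summable.mul_of_nonneg hb1.summable ha0 hb0)
  have hd : HasSum (fun z : S × T => (p z - a z.1 * b z.2) / Real.log 2) 0 := by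
    have := (hp1.sub hab).div_const (Real.log 2)
    simpa using this
  have hR := (h1.add h2').sub hd
  rw [sub_zero] at hR
  refine hasSum_le (fun z => ?_) hs.hasSum hR
  obtain ⟨s, t⟩ := z
  have hl2 : 0 < Real.log 2 := Real.log_pos (by norm_num)
  rcases (hp (s, t)).eq_or_lt with h | h
  · simp only [ef, ← h]
    have := mul_nonneg (ha0 s) (hb0 t)
    have h3 : 0 ≤ a s * b t / Real.log 2 := by positivity
    simp only [zero_mul, neg_zero, zero_sub, neg_div, zero_add]
    linarith
  · have hA : 0 < a s := h.trans_le (hle s t)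
    have hB : 0 < b t := h.trans_le (hle' s t)
    have key := Real.log_le_sub_one_of_pos (x := a s * b t / p (s, t)) (by positivity)
    rw [Real.log_div (by positivity) h.ne', Real.log_mul hA.ne' hB.ne'] at key
    have key2 := mul_le_mul_of_nonneg_left key h.le
    have e : p (s, t) * (a s * b t / p (s, t) - 1) = a s * b t - p (s, t) := by
      field_simp
    rw [e] at key2
    simp only [ef, Real.logb]
    have : 0 ≤ (a s * b t - p (s, t) -
        p (s, t) * (Real.log (a s) + Real.log (b t) - Real.log (p (s, t)))) / Real.log 2 :=
      div_nonneg (by linarith) hl2.le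
    have e2 : p (s, t) * -(Real.log (a s) / Real.log 2) + p (s, t) * -(Real.log (b t) / Real.log 2)
        - (p (s, t) - a s * b t) / Real.log 2 - -(p (s, t) * (Real.log (p (s, t)) / Real.log 2))
        = (a s * b t - p (s, t) -
        p (s, t) * (Real.log (a s) + Real.log (b t) - Real.log (p (s, t)))) / Real.log 2 := by
      field_simp; ring
    linarith

lemma hasSum_one {Ω S : Type*} [MeasurableSpace Ω] [Countable S] [MeasurableSpace S]
    [MeasurableSingletonClass S] (μ : Measure Ω) [IsProbabilityMeasure μ] (A : Ω → S)
    (hA : Measurable A) : HasSum (fun s => (μ (A ⁻¹' {s})).toReal) 1 := by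
  have h : ∑' s, μ (A ⁻¹' {s}) = 1 := by
    rw [← measure_iUnion]
    · have : (⋃ i, A ⁻¹' {i}) = Set.univ := by ext ω; simp
      rw [this, measure_univ]
    · intro i j hij
      exact Disjoint.preimage _ (by simpa using hij)
    · intro i; exact hA (measurableSet_singleton i)
  have := ENNReal.hasSum_toReal (f := fun s => μ (A ⁻¹' {s})) (by rw [h]; simp)
  rwa [← ENNReal.tsum_toReal_eq (fun s => measure_ne_top _ _), h, ENNReal.toReal_one] at this

lemma hasSum_marg {Ω S T : Type*} [MeasurableSpace Ω] [MeasurableSpace S]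
    [MeasurableSingletonClass S] [Countable T] [MeasurableSpace T]
    [MeasurableSingletonClass T] (μ : Measure Ω) [IsProbabilityMeasure μ] (A : Ω → S) (B : Ω → T)
    (hA : Measurable A) (hB : Measurable B) (s : S) :
    HasSum (fun t => (μ ((fun ω => (A ω, B ω)) ⁻¹' {(s, t)})).toReal) (μ (A ⁻¹' {s})).toReal := by
  have h : ∑' t, μ ((fun ω => (A ω, B ω)) ⁻¹' {(s, t)}) = μ (A ⁻¹' {s}) := by
    rw [← measure_iUnion]
    · congr 1; ext ω; simp
    · intro i j hij
      exact Disjoint.preimage _ (by simpa using hij)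
    · intro i; exact (hA.prodMk hB) (measurableSet_singleton _)
  have := ENNReal.hasSum_toReal (f := fun t => μ ((fun ω => (A ω, B ω)) ⁻¹' {(s, t)}))
    (by rw [h]; simp)
  rwa [← ENNReal.tsum_toReal_eq (fun s => measure_ne_top _ _), h] at this

lemma finEnt_fst {Ω S T : Type*} [MeasurableSpace Ω] [MeasurableSpace S]
    [MeasurableSingletonClass S] [Countable T] [MeasurableSpace T]
    [MeasurableSingletonClass T] (μ : Measure Ω) [IsProbabilityMeasure μ] (A : Ω → S) (B : Ω → T)
    (hA : Measurable A) (hB : Measurable B) (h : FinEnt μ (fun ω => (A ω, B ω))) : FinEnt μ A :=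
  ef_marg (fun z => (μ ((fun ω => (A ω, B ω)) ⁻¹' {z})).toReal) (fun s => (μ (A ⁻¹' {s})).toReal)
    (fun _ => ENNReal.toReal_nonneg) (hasSum_marg μ A B hA hB)
    (fun s => ENNReal.toReal_le_of_le_ofReal zero_le_one (by simpa using prob_le_one)) h

lemma entH_pair_le {Ω S T : Type*} [MeasurableSpace Ω] [Countable S] [MeasurableSpace S]
    [MeasurableSingletonClass S] [Countable T] [MeasurableSpace T]
    [MeasurableSingletonClass T] (μ : Measure Ω) [IsProbabilityMeasure μ] (A : Ω → S) (B : Ω → T)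
    (hA : Measurable A) (hB : Measurable B) (h : FinEnt μ (fun ω => (A ω, B ω)))
    (h1 : FinEnt μ A) (h2 : FinEnt μ B) :
    entH μ (fun ω => (A ω, B ω)) ≤ entH μ A + entH μ B := by
  refine ef_subadd (fun z => (μ ((fun ω => (A ω, B ω)) ⁻¹' {z})).toReal)
    (fun s => (μ (A ⁻¹' {s})).toReal) (fun s => (μ (B ⁻¹' {s})).toReal)
    (fun _ => ENNReal.toReal_nonneg) (hasSum_marg μ A B hA hB) (fun t => ?_)
    (hasSum_one μ A hA) (hasSum_one μ B hB) (hasSum_one μ _ (hA.prodMk hB)) h h1 h2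
  convert hasSum_marg μ B A hB hA t using 5 with s
  ext ω; simp [and_comm]

lemma pre_equiv {Ω S T : Type*} (e : S ≃ T) (Z : Ω → S) (s : S) :
    (fun ω => e (Z ω)) ⁻¹' {e s} = Z ⁻¹' {s} := by
  ext ω; simp

lemma finEnt_equiv {Ω S T : Type*} [MeasurableSpace Ω] (μ : Measure Ω) (e : S ≃ T) (Z : Ω → S)
    (h : FinEnt μ Z) : FinEnt μ (fun ω => e (Z ω)) := by
  unfold FinEnt at *
  rw [← e.summable_iff]
  simpa only [Function.comp_def, pre_equiv] using h

lemma entH_equiv {Ω S T : Type*} [MeasurableSpace Ω] (μ : Measure Ω) (e : S ≃ T) (Z : Ω → S) :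
    entH μ (fun ω => e (Z ω)) = entH μ Z := by
  unfold entH
  rw [← e.tsum_eq]
  simp only [pre_equiv]

/-- The map `(x, y) ↦ (x + y, y)`. -/
def eqA (G : Type*) [AddCommGroup G] : G × G ≃ G × G where
  toFun z := (z.1 + z.2, z.2)
  invFun z := (z.1 - z.2, z.2)
  left_inv z := by simp
  right_inv z := by simp

/-- The map `(x, y) ↦ (x + y, x)`. -/
def eqB (G : Type*) [AddCommGroup G] : G × G ≃ G × G where
  toFun z := (z.1 + z.2, z.1)
  invFun z := (z.2, z.1 - z.2)
  left_inv z := by simp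
  right_inv z := by simp

/-- If `𝐀{X,Y} ≥ (3/2)·H{X} + (3/2)·H{Y} − log C`, then
`H{X} − 2·log C ≤ H{Y} ≤ H{X} + 2·log C`, where `𝐀{X,Y} = 2·H{X,Y} − H{X+Y}`. -/
theorem stmt8 {Ω G : Type*} [MeasurableSpace Ω] [AddCommGroup G] [Countable G]
    [MeasurableSpace G] [MeasurableSingletonClass G]
    (μ : Measure Ω) [IsProbabilityMeasure μ]
    (X Y : Ω → G) (hmX : Measurable X) (hmY : Measurable Y)
    (hfX : FinEnt μ X) (hfY : FinEnt μ Y)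
    (hfXY : FinEnt μ (fun ω => (X ω, Y ω)))
    (C : ℝ) (hC : 0 < C)
    (h : 2 * entH μ (fun ω => (X ω, Y ω)) - entH μ (fun ω => X ω + Y ω)
          ≥ (3 / 2) * entH μ X + (3 / 2) * entH μ Y - Real.logb 2 C) :
    entH μ X - 2 * Real.logb 2 C ≤ entH μ Y ∧
      entH μ Y ≤ entH μ X + 2 * Real.logb 2 C := by
  have hms : Measurable (fun ω => X ω + Y ω) :=
    (measurable_of_countable (fun z : G × G => z.1 + z.2)).comp (hmX.prodMk hmY)
  have f1 : FinEnt μ (fun ω => (X ω + Y ω, Y ω)) := finEnt_equiv μ (eqA G) (fun ω => (X ω, Y ω)) hfXY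
  have f2 : FinEnt μ (fun ω => (X ω + Y ω, X ω)) := finEnt_equiv μ (eqB G) (fun ω => (X ω, Y ω)) hfXY
  have g1 : entH μ (fun ω => (X ω + Y ω, Y ω)) = entH μ (fun ω => (X ω, Y ω)) :=
    entH_equiv μ (eqA G) (fun ω => (X ω, Y ω))
  have g2 : entH μ (fun ω => (X ω + Y ω, X ω)) = entH μ (fun ω => (X ω, Y ω)) :=
    entH_equiv μ (eqB G) (fun ω => (X ω, Y ω))
  have fs := finEnt_fst μ (fun ω => X ω + Y ω) Y hms hmY f1
  have k0 := entH_pair_le μ X Y hmX hmY hfXY hfX hfY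
  have k1 := entH_pair_le μ (fun ω => X ω + Y ω) Y hms hmY f1 fs hfY
  have k2 := entH_pair_le μ (fun ω => X ω + Y ω) X hms hmX f2 fs hfX
  rw [g1] at k1
  rw [g2] at k2
  clear g1 g2 f1 f2 fs hfX hfY hfXY
  generalize entH μ (fun ω => (X ω, Y ω)) = a at *
  generalize entH μ (fun ω => X ω + Y ω) = b at *
  generalize entH μ X = c at *
  generalize entH μ Y = d at *
  generalize Real.logb 2 C = l at *
  constructor <;> linarith
end

section
/- There exist independent integer-valued discrete random variables X and Y such that A{X,Y} > (1/2)·A{X,X'} + (1/2)·A{Y,Y'}, where X' is an independent copy of X and Y' is an independent copy of Y. (Indeed one may take X uniform on A = {−7,−5,−4,−3,0,4,5,7} ⊆ ℤ and Y uniform on −A, with X and Y independent.) In particular, the Cauchy–Schwarz-type inequality A{X,Y} ≤ (1/2)·A{X,X'} + (1/2)·A{Y,Y'} fails in general. -/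
open MeasureTheory ProbabilityTheory Real

/-- The uniform measure on eight points. -/
noncomputable def nu8 : Measure (Fin 8) := uniformOn Set.univ

instance nu8_prob : IsProbabilityMeasure nu8 :=
  isProbabilityMeasure_uniformOn Set.finite_univ Set.univ_nonempty

/-- The eight-point set of the paper. -/
def aa : Fin 8 → ℤ := ![-7, -5, -4, -3, 0, 4, 5, 7]

/-- Size of the fibre of `f` through `w`. -/
def fib {S : Type} [DecidableEq S] (f : Fin 8 × Fin 8 → S) (w : Fin 8 × Fin 8) : ℕ :=
  (Finset.univ.filter fun v => f v = f w).card

lemma nu8_singleton (i : Fin 8) : nu8 {i} = 1 / 8 := by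
  simp [nu8, uniformOn_univ]

lemma mu_real (s : Finset (Fin 8 × Fin 8)) :
    ((nu8.prod nu8) (s : Set (Fin 8 × Fin 8))).toReal = s.card / 64 := by
  rw [← sum_measure_singleton]
  have h : ∀ w ∈ s, (nu8.prod nu8) {w} = ENNReal.ofReal (1 / 64) := by
    rintro ⟨i, j⟩ _
    rw [← Set.singleton_prod_singleton, Measure.prod_prod, nu8_singleton, nu8_singleton]
    rw [show (1 / 64 : ℝ) = (1 / 8) * (1 / 8) by norm_num, ENNReal.ofReal_mul (by norm_num),
      ENNReal.ofReal_div_of_pos (by norm_num)]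
    simp
  rw [Finset.sum_congr rfl h]
  simp
  ring

lemma entH_formula {S : Type} [DecidableEq S] (f : Fin 8 × Fin 8 → S) :
    entH (nu8.prod nu8) f = ∑ w, -((1 / 64 : ℝ) * Real.logb 2 ((fib f w : ℝ) / 64)) := by
  have hm : ∀ s, ((nu8.prod nu8) (f ⁻¹' {s})).toReal
      = ((Finset.univ.filter fun v => f v = s).card : ℝ) / 64 := by
    intro s
    rw [← mu_real]
    congr 2
    ext; simp
  unfold entH
  simp only [hm]
  rw [tsum_eq_sum (s := Finset.univ.image f)]
  · rw [← Finset.sum_fiberwise_of_maps_to (s := Finset.univ) (t := Finset.univ.image f) (g := f)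
      (fun w _ => Finset.mem_image_of_mem f (Finset.mem_univ w))]
    refine Finset.sum_congr rfl fun s _ => ?_
    rw [Finset.sum_congr rfl (g := fun _ => -((1 / 64 : ℝ) * Real.logb 2
      (((Finset.univ.filter fun v => f v = s).card : ℝ) / 64)))]
    · rw [Finset.sum_const, nsmul_eq_mul]
      ring
    · intro w hw
      rw [Finset.mem_filter] at hw
      rw [fib, hw.2]
  · intro s hs
    have : (Finset.univ.filter fun v => f v = s) = ∅ := by
      ext v
      simp only [Finset.mem_filter, Finset.mem_univ, true_and, Finset.notMem_empty, iff_false]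
      rintro rfl
      exact hs (Finset.mem_image_of_mem f (Finset.mem_univ v))
    simp [this]

lemma entH_count {S : Type} [DecidableEq S] (f : Fin 8 × Fin 8 → S)
    (h : ∀ w, fib f w ∈ Finset.range 9) :
    entH (nu8.prod nu8) f = ∑ k ∈ Finset.range 9,
      ((Finset.univ.filter fun w => fib f w = k).card : ℝ) *
        -((1 / 64 : ℝ) * Real.logb 2 ((k : ℝ) / 64)) := by
  rw [entH_formula, ← Finset.sum_fiberwise_of_maps_to (s := Finset.univ) (t := Finset.range 9)
    (g := fib f) (fun w _ => h w)]
  refine Finset.sum_congr rfl fun k _ => ?_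
  rw [Finset.sum_congr rfl (g := fun _ => -((1 / 64 : ℝ) * Real.logb 2 ((k : ℝ) / 64)))]
  · rw [Finset.sum_const, nsmul_eq_mul]
  · intro w hw
    rw [Finset.mem_filter] at hw
    rw [hw.2]

lemma entH_inj {S : Type} [DecidableEq S] (f : Fin 8 × Fin 8 → S) (hf : Function.Injective f) :
    entH (nu8.prod nu8) f = -Real.logb 2 (1 / 64) := by
  rw [entH_formula]
  have : ∀ w, fib f w = 1 := by
    intro w
    rw [fib, Finset.card_eq_one]
    exact ⟨w, by ext v; simp [hf.eq_iff]⟩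
  simp [this]

lemma logb_div64 (k : ℝ) (hk : 0 < k) : Real.logb 2 (k / 64) = Real.logb 2 k - 6 := by
  rw [Real.logb_div hk.ne' (by norm_num), show (64 : ℝ) = 2 ^ (6 : ℕ) by norm_num,
    Real.logb_pow, Real.logb_self_eq_one (by norm_num)]
  norm_num

lemma logb_four : Real.logb 2 4 = 2 := by
  rw [show (4 : ℝ) = 2 ^ (2 : ℕ) by norm_num, Real.logb_pow, Real.logb_self_eq_one (by norm_num)]
  norm_num

lemma logb_eight : Real.logb 2 8 = 3 := by
  rw [show (8 : ℝ) = 2 ^ (3 : ℕ) by norm_num, Real.logb_pow, Real.logb_self_eq_one (by norm_num)]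
  norm_num

lemma entH_of_counts (f : Fin 8 × Fin 8 → ℤ) (h : ∀ w, fib f w ∈ Finset.range 9)
    (c : ℕ → ℕ) (hc : ∀ k ∈ Finset.range 9, (Finset.univ.filter fun w => fib f w = k).card = c k)
    (h0 : c 0 = 0) (h5 : c 5 = 0) (h6 : c 6 = 0) :
    entH (nu8.prod nu8) f = -(1 / 64 : ℝ) * (c 1 * (-6) + c 2 * (1 - 6) +
      c 3 * (Real.logb 2 3 - 6) + c 4 * (2 - 6) + c 7 * (Real.logb 2 7 - 6) + c 8 * (3 - 6)) := by
  rw [entH_count f h, Finset.sum_congr rfl (fun k hk => by rw [hc k hk])]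
  simp only [Finset.sum_range_succ, Finset.sum_range_zero, h0, h5, h6]
  push_cast
  rw [logb_div64 1 (by norm_num), logb_div64 2 (by norm_num), logb_div64 3 (by norm_num),
    logb_div64 4 (by norm_num), logb_div64 7 (by norm_num), logb_div64 8 (by norm_num),
    logb_four, logb_eight, Real.logb_one, Real.logb_self_eq_one (by norm_num)]
  ring

lemma entH_sum : entH (nu8.prod nu8) (fun w => aa w.1 + aa w.2) =
    -(1 / 64 : ℝ) * (5 * (-6) + 26 * (1 - 6) + 6 * (Real.logb 2 3 - 6) + 20 * (2 - 6) +
      7 * (Real.logb 2 7 - 6)) := by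
  rw [entH_of_counts _ (by decide +kernel)
    (fun k => if k = 1 then 5 else if k = 2 then 26 else if k = 3 then 6 else
      if k = 4 then 20 else if k = 7 then 7 else 0) (by decide +kernel) rfl rfl rfl]
  norm_num

lemma entH_negsum : entH (nu8.prod nu8) (fun w => -aa w.2 + -aa w.1) =
    -(1 / 64 : ℝ) * (5 * (-6) + 26 * (1 - 6) + 6 * (Real.logb 2 3 - 6) + 20 * (2 - 6) +
      7 * (Real.logb 2 7 - 6)) := by
  rw [entH_of_counts _ (by decide +kernel)
    (fun k => if k = 1 then 5 else if k = 2 then 26 else if k = 3 then 6 else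
      if k = 4 then 20 else if k = 7 then 7 else 0) (by decide +kernel) rfl rfl rfl]
  norm_num

lemma entH_diff : entH (nu8.prod nu8) (fun w => aa w.1 + -aa w.2) =
    -(1 / 64 : ℝ) * (2 * (-6) + 24 * (1 - 6) + 30 * (Real.logb 2 3 - 6) + 8 * (3 - 6)) := by
  rw [entH_of_counts _ (by decide +kernel)
    (fun k => if k = 1 then 2 else if k = 2 then 24 else if k = 3 then 30 else
      if k = 8 then 8 else 0) (by decide +kernel) rfl rfl rfl]
  norm_num

lemma key_ineq : 18 + 7 * Real.logb 2 7 < 24 * Real.logb 2 3 := by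
  have h : Real.logb 2 ((2 : ℝ) ^ (18 : ℕ) * 7 ^ (7 : ℕ)) < Real.logb 2 ((3 : ℝ) ^ (24 : ℕ)) :=
    Real.logb_lt_logb (by norm_num) (by norm_num) (by norm_num)
  rw [Real.logb_mul (by norm_num) (by norm_num), Real.logb_pow, Real.logb_pow, Real.logb_pow,
    Real.logb_self_eq_one (by norm_num)] at h
  push_cast at h
  linarith

lemma aa_inj : Function.Injective aa := by decide +kernel

lemma ident_swap (g : Fin 8 → ℤ) : IdentDistrib (fun w : Fin 8 × Fin 8 => g w.1)
    (fun w : Fin 8 × Fin 8 => g w.2) (nu8.prod nu8) (nu8.prod nu8) := by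
  have hg : Measurable g := measurable_of_countable g
  refine ⟨(hg.comp measurable_fst).aemeasurable, (hg.comp measurable_snd).aemeasurable, ?_⟩
  have h1 := Measure.map_map (μ := nu8.prod nu8) hg measurable_fst
  have h2 := Measure.map_map (μ := nu8.prod nu8) hg measurable_snd
  rw [← Measure.fst, Measure.fst_prod] at h1
  rw [← Measure.snd, Measure.snd_prod] at h2
  exact h1.symm.trans h2

lemma indep_coords (g h : Fin 8 → ℤ) : IndepFun (fun w : Fin 8 × Fin 8 => g w.1)
    (fun w : Fin 8 × Fin 8 => h w.2) (nu8.prod nu8) :=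
  indepFun_prod (measurable_of_countable g) (measurable_of_countable h)

/-- There exist independent integer-valued discrete random variables `X` and `Y`
(together with an independent copy `X'` of `X` and an independent copy `Y'` of `Y`)
such that `𝐀{X,Y} > (1/2)·𝐀{X,X'} + (1/2)·𝐀{Y,Y'}`, where `𝐀{X,Y} = 2·H{X,Y} − H{X+Y}`;
i.e. the Cauchy–Schwarz-type inequality for entropic additive energy fails in general. -/
theorem stmt16 :
    ∃ (Ω : Type) (_ : MeasurableSpace Ω) (μ : Measure Ω) (_ : IsProbabilityMeasure μ)
      (X Y X' Y' : Ω → ℤ),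
      Measurable X ∧ Measurable Y ∧ Measurable X' ∧ Measurable Y' ∧
      IndepFun X Y μ ∧
      IndepFun X X' μ ∧ IdentDistrib X X' μ μ ∧
      IndepFun Y Y' μ ∧ IdentDistrib Y Y' μ μ ∧
      2 * entH μ (fun ω => (X ω, Y ω)) - entH μ (fun ω => X ω + Y ω) >
        (1 / 2) * (2 * entH μ (fun ω => (X ω, X' ω)) - entH μ (fun ω => X ω + X' ω)) +
        (1 / 2) * (2 * entH μ (fun ω => (Y ω, Y' ω)) - entH μ (fun ω => Y ω + Y' ω)) := by
  refine ⟨Fin 8 × Fin 8, inferInstance, nu8.prod nu8, inferInstance,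
    fun w => aa w.1, fun w => -aa w.2, fun w => aa w.2, fun w => -aa w.1,
    measurable_of_countable _, measurable_of_countable _, measurable_of_countable _,
    measurable_of_countable _, indep_coords aa (fun i => -aa i), indep_coords aa aa,
    ident_swap aa, (indep_coords (fun i => -aa i) (fun i => -aa i)).symm,
    (ident_swap (fun i => -aa i)).symm, ?_⟩
  rw [entH_sum, entH_diff, entH_negsum, entH_inj (fun w => (aa w.1, -aa w.2)),
    entH_inj (fun w => (aa w.1, aa w.2)), entH_inj (fun w => (-aa w.2, -aa w.1))]
  · have := key_ineq
    linarith
  all_goals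
    rintro ⟨i, j⟩ ⟨k, l⟩ h
    simp only [Prod.mk.injEq, neg_inj, aa_inj.eq_iff] at h
    simp [h]
end
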